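/- For every z ∈ closure(U) \ K there exists z̄ ∈ Λ with z̄ ≠ 0 such that both z + z̄ ∈ closure(U) and z − z̄ ∈ closure(U). -/

import Mathlib

noncomputable section

open Matrix

abbrev En (n : ℕ) := EuclideanSpace ℝ (Fin n)

/-- The space of symmetric trace-free `n × n` real matrices, as a submodule. -/
def S0 (n : ℕ) : Submodule ℝ (Matrix (Fin n) (Fin n) ℝ) where
  carrier := {σ | σ.IsSymm ∧ σ.trace = 0}
  add_mem' := fun hA hB => ⟨hA.1.add hB.1, by simp [Matrix.trace_add, hA.2, hB.2]⟩
  zero_mem' := ⟨Matrix.isSymm_zero, by simp⟩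
  smul_mem' := fun c A hA => ⟨by rw [Matrix.IsSymm, Matrix.transpose_smul, hA.1], by simp [hA.2]⟩

/-- The state space `Z = ℝ × ℝⁿ × ℝⁿ × S₀ × ℝ`. -/
abbrev Zsp (n : ℕ) := ℝ × En n × En n × ↥(S0 n) × ℝ

/-- Outer product `w ⊗ m`. -/
def op {n : ℕ} (w m : En n) : Matrix (Fin n) (Fin n) ℝ := fun i j => w i * m j

/-- The largest eigenvalue of a (symmetric) matrix, as `sup {ξᵀ A ξ : |ξ| = 1}`. -/
def lamMax {n : ℕ} (A : Matrix (Fin n) (Fin n) ℝ) : ℝ :=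
  sSup {r | ∃ ξ : En n, ‖ξ‖ = 1 ∧ r = ∑ i, ∑ j, ξ i * A i j * ξ j}

/-- The matrix `M(z)`. -/
def Mmat {n : ℕ} (μm μp μ : ℝ) (w m : En n) (σ : Matrix (Fin n) (Fin n) ℝ) :
    Matrix (Fin n) (Fin n) ℝ :=
  (((μp - μ) * (μ - μm))⁻¹) •
      ((μ * μm * μp) • op w w - (μm * μp) • (op m w + op w m) + (μp + μm - μ) • op m m) - σ

/-- `T₊(z)`. -/
def Tp {n : ℕ} (μm μp μ : ℝ) (w m : En n) : ℝ :=
  (μp / (n : ℝ)) * ‖m - μm • w‖ ^ 2 / (μ - μm) ^ 2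

/-- `T₋(z)`. -/
def Tm {n : ℕ} (μm μp μ : ℝ) (w m : En n) : ℝ :=
  (μm / (n : ℝ)) * ‖m - μp • w‖ ^ 2 / (μ - μp) ^ 2

def TpZ {n : ℕ} (μm μp : ℝ) (z : Zsp n) : ℝ := Tp μm μp z.1 z.2.1 z.2.2.1

def TmZ {n : ℕ} (μm μp : ℝ) (z : Zsp n) : ℝ := Tm μm μp z.1 z.2.1 z.2.2.1

def QZ {n : ℕ} (μm μp : ℝ) (z : Zsp n) : ℝ :=
  lamMax (Mmat μm μp z.1 z.2.1 z.2.2.1 (z.2.2.2.1 : Matrix (Fin n) (Fin n) ℝ))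

/-- The open relaxed set `U`. -/
def Uset (n : ℕ) (μm μp e : ℝ) : Set (Zsp n) :=
  {z | z.1 ∈ Set.Ioo μm μp ∧ TpZ μm μp z < e ∧ TmZ μm μp z < e ∧ QZ μm μp z < e}

/-- The constraint set `K`. -/
def Kset (n : ℕ) (μm μp e : ℝ) : Set (Zsp n) :=
  {z | (z.1 = μm ∨ z.1 = μp) ∧ z.2.2.1 = z.1 • z.2.1 ∧
    z.1 • op z.2.1 z.2.1 - (z.2.2.2.1 : Matrix (Fin n) (Fin n) ℝ) =
      e • (1 : Matrix (Fin n) (Fin n) ℝ)}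

/-- The wave cone `Λ`. -/
def Lambda (n : ℕ) : Set (Zsp n) :=
  {z | ¬(z.1 = 0 ∧ z.2.2.1 = 0) ∧
    ∃ (ξ : Fin n → ℝ) (c : ℝ), ¬(ξ = 0 ∧ c = 0) ∧
      ((z.2.2.2.1 : Matrix (Fin n) (Fin n) ℝ) +
          z.2.2.2.2 • (1 : Matrix (Fin n) (Fin n) ℝ)).mulVec ξ + c • (fun i => z.2.2.1 i) = 0 ∧
      (∑ j, z.2.2.1 j * ξ j) + c * z.1 = 0 ∧
      (∑ j, z.2.1 j * ξ j) = 0}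

/-- The projection `π(μ, w, m, σ, q) = (μ, w, m, σ)`. -/
def pz {n : ℕ} (z : Zsp n) : ℝ × En n × En n × ↥(S0 n) := (z.1, z.2.1, z.2.2.1, z.2.2.2.1)

section QuadraticForm

variable {n : ℕ}

/-- The quadratic form `ξᵀ A ξ` of a matrix. -/
def quadForm (A : Matrix (Fin n) (Fin n) ℝ) (ξ : En n) : ℝ :=
  ∑ i, ∑ j, ξ i * A i j * ξ j

lemma quadForm_eq_dotProduct (A : Matrix (Fin n) (Fin n) ℝ) (ξ : En n) :
    quadForm A ξ = ξ.ofLp ⬝ᵥ A *ᵥ ξ.ofLp := by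
  simp [quadForm, dotProduct, mulVec, Finset.mul_sum, mul_assoc]

lemma quadForm_add (A B : Matrix (Fin n) (Fin n) ℝ) (ξ : En n) :
    quadForm (A + B) ξ = quadForm A ξ + quadForm B ξ := by
  simp [quadForm_eq_dotProduct, add_mulVec]

lemma quadForm_sub (A B : Matrix (Fin n) (Fin n) ℝ) (ξ : En n) :
    quadForm (A - B) ξ = quadForm A ξ - quadForm B ξ := by
  simp [quadForm_eq_dotProduct, sub_mulVec]

lemma quadForm_smul (c : ℝ) (A : Matrix (Fin n) (Fin n) ℝ) (ξ : En n) :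
    quadForm (c • A) ξ = c * quadForm A ξ := by
  simp [quadForm_eq_dotProduct, smul_mulVec]

lemma quadForm_smul_vector (A : Matrix (Fin n) (Fin n) ℝ) (c : ℝ) (ξ : En n) :
    quadForm A (c • ξ) = c ^ 2 * quadForm A ξ := by
  simp [quadForm_eq_dotProduct, mulVec_smul]
  ring

lemma inner_eq_sum (a b : En n) : inner ℝ a b = ∑ i, a i * b i := by
  simp [PiLp.inner_apply, mul_comm]

lemma norm_sq_eq_sum (a : En n) : ‖a‖ ^ 2 = ∑ i, a i * a i := by
  rw [← real_inner_self_eq_norm_sq, inner_eq_sum]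

lemma quadForm_op (a b ξ : En n) :
    quadForm (op a b) ξ = inner ℝ a ξ * inner ℝ b ξ := by
  simp only [quadForm, op, inner_eq_sum, Finset.sum_mul_sum]
  exact Finset.sum_congr rfl fun i _ => Finset.sum_congr rfl fun j _ => by ring

lemma quadForm_one (ξ : En n) : quadForm 1 ξ = ‖ξ‖ ^ 2 := by
  rw [quadForm_eq_dotProduct, one_mulVec, norm_sq_eq_sum]
  rfl

lemma trace_op (a b : En n) : (op a b).trace = inner ℝ a b := by
  simp [Matrix.trace, op, inner_eq_sum]

lemma op_mulVec (a b : En n) (v : Fin n → ℝ) : op a b *ᵥ v = (b.ofLp ⬝ᵥ v) • a.ofLp := by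
  ext i
  simp only [mulVec, dotProduct, op, Pi.smul_apply, smul_eq_mul, Finset.sum_mul]
  exact Finset.sum_congr rfl fun j _ => by ring

lemma posSemidef_of_quadForm_nonneg {A : Matrix (Fin n) (Fin n) ℝ} (hA : A.IsSymm)
    (h : ∀ ξ, 0 ≤ quadForm A ξ) : A.PosSemidef := by
  have hA' : A.IsHermitian := by rwa [IsHermitian, conjTranspose_eq_transpose_of_trivial]
  refine .of_dotProduct_mulVec_nonneg hA' fun x => ?_
  simpa [quadForm_eq_dotProduct] using h (WithLp.toLp 2 x)

/-- The value of a quadratic form on `ξ + x eⱼ`. -/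
lemma quadForm_add_single {A : Matrix (Fin n) (Fin n) ℝ} (hA : A.IsSymm) (ξ : En n) (j : Fin n)
    (x : ℝ) : quadForm A (ξ + x • EuclideanSpace.single j 1) =
      quadForm A ξ + 2 * x * ∑ i, A i j * ξ i + x ^ 2 * A j j := by
  have h : ξ.ofLp ⬝ᵥ A.col j = ∑ i, A i j * ξ i := by simp [dotProduct, mul_comm]
  have h' : (A *ᵥ ξ.ofLp) j = ∑ i, A i j * ξ i := by
    simp [mulVec, dotProduct, hA.apply _ j]
  simp [quadForm_eq_dotProduct, mulVec_add, mulVec_smul, h, h']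
  ring

/-- Cauchy–Schwarz for a nonnegative quadratic form, tested against a basis vector. -/
lemma sq_column_inner_le {A : Matrix (Fin n) (Fin n) ℝ} (hA : A.IsSymm)
    (h : ∀ ξ, 0 ≤ quadForm A ξ) {j : Fin n} (hj : 0 < A j j) (ξ : En n) :
    (∑ i, A i j * ξ i) ^ 2 ≤ A j j * quadForm A ξ := by
  have := h (ξ + (-(∑ i, A i j * ξ i) / A j j) • EuclideanSpace.single j 1)
  rw [quadForm_add_single hA] at this
  have key := mul_nonneg hj.le this
  field_simp at key
  nlinarith

lemma bddAbove_quadForm_sphere (A : Matrix (Fin n) (Fin n) ℝ) :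
    BddAbove {r | ∃ ξ : En n, ‖ξ‖ = 1 ∧ r = ∑ i, ∑ j, ξ i * A i j * ξ j} := by
  refine ⟨∑ i, ∑ j, |A i j|, ?_⟩
  rintro r ⟨ξ, hξ, rfl⟩
  have hc (i) : |ξ i| ≤ 1 := by simpa [hξ] using PiLp.norm_apply_le ξ i
  refine Finset.sum_le_sum fun i _ => Finset.sum_le_sum fun j _ => (le_abs_self _).trans ?_
  rw [abs_mul, abs_mul]
  calc |ξ i| * |A i j| * |ξ j| ≤ 1 * |A i j| * 1 := by gcongr <;> exact hc _
    _ = |A i j| := by ring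

lemma quadForm_le_lamMax (A : Matrix (Fin n) (Fin n) ℝ) (ξ : En n) :
    quadForm A ξ ≤ lamMax A * ‖ξ‖ ^ 2 := by
  rcases eq_or_ne ξ 0 with rfl | hξ
  · simp [quadForm]
  have hpos : 0 < ‖ξ‖ := norm_pos_iff.mpr hξ
  have h : quadForm A (‖ξ‖⁻¹ • ξ) ≤ lamMax A :=
    le_csSup (bddAbove_quadForm_sphere A) ⟨_, by simp [norm_smul, hpos.ne'], rfl⟩
  rw [quadForm_smul_vector] at h
  field_simp at h
  linarith

lemma lamMax_le (hn : 0 < n) {A : Matrix (Fin n) (Fin n) ℝ} {c : ℝ}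
    (h : ∀ ξ : En n, ‖ξ‖ = 1 → quadForm A ξ ≤ c) : lamMax A ≤ c := by
  refine csSup_le ⟨_, EuclideanSpace.single ⟨0, hn⟩ 1, by simp, rfl⟩ ?_
  rintro r ⟨ξ, hξ, rfl⟩
  exact h ξ hξ

end QuadraticForm

section WaveCone

variable {n : ℕ}

lemma op_transpose (a b : En n) : (op a b)ᵀ = op b a := by
  ext i j
  simp [op, mul_comm]

lemma smul_mem_Lambda {z : Zsp n} (hz : z ∈ Lambda n) {r : ℝ} (hr : r ≠ 0) :
    r • z ∈ Lambda n := by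
  obtain ⟨h0, ξ, c, hξ, h1, h2, h3⟩ := hz
  refine ⟨by simpa [hr] using h0, ξ, c, hξ, ?_, ?_, ?_⟩
  · convert congrArg (r • ·) h1 using 1
    · ext i
      simp [smul_mulVec, add_mulVec]
      ring
    · simp
  · convert congrArg (r * ·) h2 using 1
    · simp [mul_add, Finset.mul_sum, mul_assoc, mul_left_comm]
    · simp
  · convert congrArg (r * ·) h3 using 1
    · simp [Finset.mul_sum, mul_assoc]
    · simp

lemma sub_smul_eq_add_neg_smul (z v : Zsp n) (r : ℝ) : z - r • v = z + (-r) • v := by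
  module

lemma ne_zero_of_mem_Lambda {z : Zsp n} (hz : z ∈ Lambda n) : z ≠ 0 := by
  rintro rfl
  exact hz.1 ⟨rfl, rfl⟩

/-- The change of stress that compensates, up to a multiple of `α ⊗ α`, the change of `a ⊗ a` when
`a` moves in the direction `α`. -/
def velocityStress (a α : En n) : S0 n :=
  ⟨op a α + op α a - (2 * (inner ℝ a α / ‖α‖ ^ 2)) • op α α, by
    rw [IsSymm, transpose_sub, transpose_add, transpose_smul, op_transpose, op_transpose,
      op_transpose, add_comm], by
    rw [trace_sub, trace_add, trace_smul, trace_op, trace_op, trace_op, real_inner_comm a α,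
      real_inner_self_eq_norm_sq, smul_eq_mul]
    rcases eq_or_ne α 0 with rfl | hα
    · simp
    · have : ‖α‖ ≠ 0 := norm_ne_zero_iff.mpr hα
      field_simp
      ring⟩

/-- The direction changing the velocity of the phase of density `p` and volume fraction `s`. -/
def velocityDirection (p s : ℝ) (a α : En n) : Zsp n :=
  (0, s • α, (s * p) • α, (s * p) • velocityStress a α, 0)

lemma velocityDirection_mem_Lambda (hn : 2 ≤ n) {p s : ℝ} (hp : 0 < p) (hs : 0 < s) (a : En n)
    {α : En n} (hα : α ≠ 0) : velocityDirection p s a α ∈ Lambda n := by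
  have : Nontrivial (Fin n) := Fin.nontrivial_iff_two_le.mpr hn
  obtain ⟨ξ, hξ, hξα⟩ := exists_ne_zero_dotProduct_eq_zero α.ofLp
  rw [dotProduct_comm] at hξα
  have hsum : ∑ j, α j * ξ j = 0 := hξα
  refine ⟨by simp [velocityDirection, hs.ne', hp.ne', hα], ξ, -(a.ofLp ⬝ᵥ ξ), by simp [hξ],
    ?_, ?_, ?_⟩
  · ext i
    simp [velocityDirection, velocityStress, smul_mulVec, sub_mulVec, add_mulVec, op_mulVec, hξα]
    ring
  · simp [velocityDirection, mul_assoc, ← Finset.mul_sum, hsum]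
  · simp [velocityDirection, mul_assoc, ← Finset.mul_sum, hsum]

/-- The direction exchanging the volume fractions of two phases with densities `p`, `q`,
velocities `a`, `b` and equal kinetic energies. -/
def fractionDirection {p q : ℝ} {a b : En n} (h : p * ‖a‖ ^ 2 = q * ‖b‖ ^ 2) : Zsp n :=
  (p - q, a - b, p • a - q • b, ⟨p • op a a - q • op b b, by
    rw [IsSymm, transpose_sub, transpose_smul, transpose_smul, op_transpose, op_transpose], by
    simp [trace_op, h]⟩, 0)

lemma fractionDirection_mem_Lambda (hn : 2 ≤ n) {p q : ℝ} (hpq : p ≠ q) {a b : En n}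
    (h : p * ‖a‖ ^ 2 = q * ‖b‖ ^ 2) : fractionDirection h ∈ Lambda n := by
  have : Nontrivial (Fin n) := Fin.nontrivial_iff_two_le.mpr hn
  obtain ⟨ξ, hξ, hξ'⟩ := exists_ne_zero_dotProduct_eq_zero (a - b).ofLp
  rw [dotProduct_comm, WithLp.ofLp_sub, sub_dotProduct, sub_eq_zero] at hξ'
  have hsum : ∑ j, a j * ξ j = ∑ j, b j * ξ j := hξ'
  refine ⟨by simp [fractionDirection, sub_eq_zero, hpq], ξ, -(b.ofLp ⬝ᵥ ξ), by simp [hξ],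
    ?_, ?_, ?_⟩
  · ext i
    simp [fractionDirection, smul_mulVec, sub_mulVec, op_mulVec, hξ']
    ring
  · simp [fractionDirection, dotProduct, sub_mul, mul_assoc, ← Finset.mul_sum, hsum]
    ring
  · simp [fractionDirection, sub_mul, hsum]

end WaveCone

section Mixture

variable {n : ℕ} {p q e s t : ℝ} {a b : En n} {z : Zsp n}

/-- The state `z` is a relaxed mixture of two phases with densities `p`, `q`, volume fractions
`s`, `t` and velocities `a`, `b`. -/
structure IsMixture (p q e : ℝ) (z : Zsp n) (s t : ℝ) (a b : En n) : Prop where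
  nonneg_left : 0 ≤ s
  nonneg_right : 0 ≤ t
  add_eq_one : s + t = 1
  density : z.1 = s * p + t * q
  velocity : z.2.1 = s • a + t • b
  momentum : z.2.2.1 = (s * p) • a + (t * q) • b
  energy_left : p * ‖a‖ ^ 2 ≤ n * e
  energy_right : q * ‖b‖ ^ 2 ≤ n * e
  stress : ∀ ξ : En n, s * p * inner ℝ a ξ ^ 2 + t * q * inner ℝ b ξ ^ 2 -
    quadForm (z.2.2.2.1 : Matrix (Fin n) (Fin n) ℝ) ξ ≤ e * ‖ξ‖ ^ 2

/-- The set of relaxed mixtures. -/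
def mixtureSet (n : ℕ) (p q e : ℝ) : Set (Zsp n) :=
  {z | ∃ s t a b, IsMixture p q e z s t a b}

lemma IsMixture.symm (h : IsMixture p q e z s t a b) : IsMixture q p e z t s b a where
  nonneg_left := h.nonneg_right
  nonneg_right := h.nonneg_left
  add_eq_one := by rw [add_comm, h.add_eq_one]
  density := by rw [add_comm, h.density]
  velocity := by rw [add_comm, h.velocity]
  momentum := by rw [add_comm, h.momentum]
  energy_left := h.energy_right
  energy_right := h.energy_left
  stress ξ := by linarith [h.stress ξ]

lemma mixtureSet_comm (n : ℕ) (p q e : ℝ) : mixtureSet n p q e = mixtureSet n q p e :=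
  Set.ext fun _ => ⟨fun ⟨_, _, _, _, h⟩ => ⟨_, _, _, _, h.symm⟩,
    fun ⟨_, _, _, _, h⟩ => ⟨_, _, _, _, h.symm⟩⟩

/-- The slack in the matrix inequality defining a mixture. -/
def stressGap (p q e : ℝ) (z : Zsp n) (s t : ℝ) (a b : En n) : Matrix (Fin n) (Fin n) ℝ :=
  e • 1 - (s * p) • op a a - (t * q) • op b b + z.2.2.2.1

lemma stressGap_isSymm (p q e : ℝ) (z : Zsp n) (s t : ℝ) (a b : En n) :
    (stressGap p q e z s t a b).IsSymm := by
  have : (z.2.2.2.1 : Matrix (Fin n) (Fin n) ℝ)ᵀ = z.2.2.2.1 := z.2.2.2.1.2.1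
  simp [stressGap, IsSymm, op_transpose, this]

lemma quadForm_stressGap (p q e : ℝ) (z : Zsp n) (s t : ℝ) (a b ξ : En n) :
    quadForm (stressGap p q e z s t a b) ξ = e * ‖ξ‖ ^ 2 - s * p * inner ℝ a ξ ^ 2 -
      t * q * inner ℝ b ξ ^ 2 + quadForm (z.2.2.2.1 : Matrix (Fin n) (Fin n) ℝ) ξ := by
  simp only [stressGap, quadForm_add, quadForm_sub, quadForm_smul, quadForm_op, quadForm_one]
  ring

lemma trace_stressGap (p q e : ℝ) (z : Zsp n) (s t : ℝ) (a b : En n) :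
    (stressGap p q e z s t a b).trace = n * e - s * (p * ‖a‖ ^ 2) - t * (q * ‖b‖ ^ 2) := by
  have : (z.2.2.2.1 : Matrix (Fin n) (Fin n) ℝ).trace = 0 := z.2.2.2.1.2.2
  simp [stressGap, trace_op, this]
  ring

lemma IsMixture.quadForm_stressGap_nonneg (h : IsMixture p q e z s t a b) (ξ : En n) :
    0 ≤ quadForm (stressGap p q e z s t a b) ξ := by
  rw [quadForm_stressGap]
  linarith [h.stress ξ]

lemma IsMixture.stressGap_eq_zero (h : IsMixture p q e z s t a b)
    (htr : (stressGap p q e z s t a b).trace = 0) : stressGap p q e z s t a b = 0 :=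
  (posSemidef_of_quadForm_nonneg (stressGap_isSymm ..)
    h.quadForm_stressGap_nonneg).trace_eq_zero_iff.mp htr

/-- If the gap has positive trace, it dominates a multiple of some `α ⊗ α` with `α ≠ 0`. -/
lemma IsMixture.exists_direction (h : IsMixture p q e z s t a b)
    (htr : 0 < (stressGap p q e z s t a b).trace) :
    ∃ (α : En n) (D : ℝ), α ≠ 0 ∧
      ∀ ξ, inner ℝ α ξ ^ 2 ≤ D * quadForm (stressGap p q e z s t a b) ξ := by
  obtain ⟨j, -, hj⟩ := Finset.exists_lt_of_sum_lt (s := Finset.univ) (f := fun _ => (0 : ℝ))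
    (by simpa [Matrix.trace] using htr)
  refine ⟨WithLp.toLp 2 fun i => stressGap p q e z s t a b i j,
    stressGap p q e z s t a b j j, fun h0 => ?_, fun ξ => ?_⟩
  · have := congrArg (fun v : En n => v j) h0
    exact hj.ne' this
  · rw [inner_eq_sum]
    exact sq_column_inner_le (stressGap_isSymm ..) h.quadForm_stressGap_nonneg hj ξ

lemma IsMixture.add_velocityDirection (h : IsMixture p q e z s t a b) {α : En n} {D r : ℝ}
    (hD : ∀ ξ, inner ℝ α ξ ^ 2 ≤ D * quadForm (stressGap p q e z s t a b) ξ)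
    (hr : s * p * (r ^ 2 + 2 * r * (inner ℝ a α / ‖α‖ ^ 2)) * D ≤ 1)
    (hE : p * ‖a + r • α‖ ^ 2 ≤ n * e) :
    IsMixture p q e (z + r • velocityDirection p s a α) s t (a + r • α) b where
  nonneg_left := h.nonneg_left
  nonneg_right := h.nonneg_right
  add_eq_one := h.add_eq_one
  density := by simp [velocityDirection, h.density]
  velocity := by
    simp [velocityDirection, h.velocity]
    module
  momentum := by
    simp [velocityDirection, h.momentum]
    module
  energy_left := hE
  energy_right := h.energy_right
  stress ξ := by
    have hX := h.quadForm_stressGap_nonneg ξ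
    have hDξ := hD ξ
    set k := s * p * (r ^ 2 + 2 * r * (inner ℝ a α / ‖α‖ ^ 2)) with hk
    have key : k * inner ℝ α ξ ^ 2 ≤ quadForm (stressGap p q e z s t a b) ξ := by
      rcases le_total k 0 with hk0 | hk0
      · exact (mul_nonpos_of_nonpos_of_nonneg hk0 (sq_nonneg _)).trans hX
      · nlinarith
    rw [quadForm_stressGap] at key
    simp only [velocityDirection, velocityStress, Prod.smul_mk, Prod.snd_add, Prod.fst_add,
      Submodule.coe_add, Submodule.coe_smul, quadForm_add, quadForm_sub, quadForm_smul,
      quadForm_op, inner_add_left, real_inner_smul_left]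
    linear_combination key

/-- If the phase of density `p` is present and its kinetic energy is not saturated, its velocity
can be perturbed. -/
lemma IsMixture.exists_perturbation_of_lt (hn : 2 ≤ n) (hp : 0 < p)
    (h : IsMixture p q e z s t a b) (hs : 0 < s) (hlt : p * ‖a‖ ^ 2 < n * e) :
    ∃ zb ∈ Lambda n, z + zb ∈ mixtureSet n p q e ∧ z - zb ∈ mixtureSet n p q e := by
  have htr : 0 < (stressGap p q e z s t a b).trace := by
    rw [trace_stressGap]
    nlinarith [mul_pos hs (sub_pos.mpr hlt), mul_nonneg h.nonneg_right
      (sub_nonneg.mpr h.energy_right), congrArg (· * (n * e)) h.add_eq_one]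
  obtain ⟨α, D, hα, hD⟩ := h.exists_direction htr
  have h1 : ∀ᶠ r in nhds (0 : ℝ),
      s * p * (r ^ 2 + 2 * r * (inner ℝ a α / ‖α‖ ^ 2)) * D < 1 :=
    ContinuousAt.eventually_lt (by fun_prop) continuousAt_const (by simp)
  have h2 : ∀ᶠ r in nhds (0 : ℝ), p * ‖a + r • α‖ ^ 2 < n * e :=
    ContinuousAt.eventually_lt (by fun_prop) continuousAt_const (by simpa using hlt)
  obtain ⟨ε, hε, hball⟩ := Metric.eventually_nhds_iff.mp (h1.and h2)
  have hmem (r : ℝ) (hr : |r| < ε) : z + r • velocityDirection p s a α ∈ mixtureSet n p q e :=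
    have hr' := hball (y := r) (by simpa using hr)
    ⟨_, _, _, _, h.add_velocityDirection hD hr'.1.le hr'.2.le⟩
  refine ⟨(ε / 2) • velocityDirection p s a α,
    smul_mem_Lambda (velocityDirection_mem_Lambda hn hp hs a hα) (half_pos hε).ne',
    hmem _ ?_, ?_⟩
  · rw [abs_of_pos (half_pos hε)]
    exact half_lt_self hε
  · rw [sub_smul_eq_add_neg_smul]
    refine hmem _ ?_
    rw [abs_neg, abs_of_pos (half_pos hε)]
    exact half_lt_self hε

lemma IsMixture.add_fractionDirection (h : IsMixture p q e z s t a b)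
    (hE : p * ‖a‖ ^ 2 = q * ‖b‖ ^ 2) {r : ℝ} (hs : 0 ≤ s + r) (ht : 0 ≤ t - r) :
    IsMixture p q e (z + r • fractionDirection hE) (s + r) (t - r) a b where
  nonneg_left := hs
  nonneg_right := ht
  add_eq_one := by linarith [h.add_eq_one]
  density := by
    simp [fractionDirection, h.density]
    ring
  velocity := by
    simp [fractionDirection, h.velocity]
    module
  momentum := by
    simp [fractionDirection, h.momentum]
    module
  energy_left := h.energy_left
  energy_right := h.energy_right
  stress ξ := by
    simp only [fractionDirection, Prod.smul_mk, Prod.snd_add, Prod.fst_add,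
      Submodule.coe_add, Submodule.coe_smul, quadForm_add, quadForm_sub, quadForm_smul,
      quadForm_op]
    linear_combination h.stress ξ

/-- If both phases are present with equal kinetic energies, the volume fractions can be
perturbed. -/
lemma IsMixture.exists_perturbation_of_eq (hn : 2 ≤ n) (hpq : p ≠ q)
    (h : IsMixture p q e z s t a b) (hs : 0 < s) (ht : 0 < t)
    (hE : p * ‖a‖ ^ 2 = q * ‖b‖ ^ 2) :
    ∃ zb ∈ Lambda n, z + zb ∈ mixtureSet n p q e ∧ z - zb ∈ mixtureSet n p q e := by
  have hr : 0 < min s t := lt_min hs ht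
  have hrs := min_le_left s t
  have hrt := min_le_right s t
  refine ⟨min s t • fractionDirection hE,
    smul_mem_Lambda (fractionDirection_mem_Lambda hn hpq hE) hr.ne',
    ⟨_, _, _, _, h.add_fractionDirection hE (by linarith) (by linarith)⟩, ?_⟩
  rw [sub_smul_eq_add_neg_smul]
  exact ⟨_, _, _, _, h.add_fractionDirection hE (by linarith) (by linarith)⟩

lemma IsMixture.pure_left (h : IsMixture p q e z s 0 a b) (hE : p * ‖a‖ ^ 2 = n * e) :
    z.1 = p ∧ z.2.2.1 = z.1 • z.2.1 ∧
      z.1 • op z.2.1 z.2.1 - (z.2.2.2.1 : Matrix (Fin n) (Fin n) ℝ) = e • 1 := by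
  obtain rfl : s = 1 := by simpa using h.add_eq_one
  have hμ : z.1 = p := by simpa using h.density
  have hw : z.2.1 = a := by simpa using h.velocity
  have hm : z.2.2.1 = p • a := by simpa using h.momentum
  have hgap := h.stressGap_eq_zero (by rw [trace_stressGap, hE]; ring)
  refine ⟨hμ, by rw [hμ, hw, hm], ?_⟩
  rw [hμ, hw]
  simp only [stressGap, one_mul, zero_mul, zero_smul, sub_zero] at hgap
  rw [eq_comm, ← sub_eq_zero, ← hgap]
  abel

lemma exists_perturbation_mixtureSet (hn : 2 ≤ n) (hp : 0 < p) (hq : 0 < q) (hpq : p ≠ q)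
    (hz : z ∈ mixtureSet n p q e) (hK : z ∉ Kset n q p e) :
    ∃ zb ∈ Lambda n, z + zb ∈ mixtureSet n p q e ∧ z - zb ∈ mixtureSet n p q e := by
  obtain ⟨s, t, a, b, h⟩ := hz
  by_cases ha : 0 < s ∧ p * ‖a‖ ^ 2 < n * e
  · exact h.exists_perturbation_of_lt hn hp ha.1 ha.2
  by_cases hb : 0 < t ∧ q * ‖b‖ ^ 2 < n * e
  · simpa only [mixtureSet_comm n p q e] using h.symm.exists_perturbation_of_lt hn hq hb.1 hb.2
  rw [not_and, not_lt] at ha hb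
  have hsum := h.add_eq_one
  rcases h.nonneg_left.eq_or_lt' with rfl | hs
  · have hE := h.energy_right.antisymm (hb (by linarith))
    obtain ⟨h1, h2, h3⟩ := h.symm.pure_left hE
    exact absurd ⟨Or.inl h1, h2, h3⟩ hK
  rcases h.nonneg_right.eq_or_lt' with rfl | ht
  · obtain ⟨h1, h2, h3⟩ := h.pure_left (h.energy_left.antisymm (ha hs))
    exact absurd ⟨Or.inr h1, h2, h3⟩ hK
  · exact h.exists_perturbation_of_eq hn hpq hs ht
      ((h.energy_left.antisymm (ha hs)).trans (h.energy_right.antisymm (hb ht)).symm)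

end Mixture

section Closure

variable {n : ℕ} {p q e s t : ℝ} {a b : En n} {z : Zsp n}

lemma Mmat_mixture (hqp : q < p) (hs : 0 < s) (ht : 0 < t) (hst : s + t = 1) (a b : En n)
    (σ : Matrix (Fin n) (Fin n) ℝ) :
    Mmat q p (s * p + t * q) (s • a + t • b) ((s * p) • a + (t * q) • b) σ =
      (s * p) • op a a + (t * q) • op b b - σ := by
  obtain rfl : t = 1 - s := by linarith
  have hd : p - q ≠ 0 := (sub_pos.mpr hqp).ne'
  have hd1 : p - (s * p + (1 - s) * q) = (1 - s) * (p - q) := by ring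
  have hd2 : s * p + (1 - s) * q - q = s * (p - q) := by ring
  rw [Mmat, hd1, hd2]
  ext i j
  simp [op]
  field_simp
  ring

lemma Tp_mixture (hqp : q < p) (hs : 0 < s) (hst : s + t = 1) (a b : En n) :
    Tp q p (s * p + t * q) (s • a + t • b) ((s * p) • a + (t * q) • b) = p * ‖a‖ ^ 2 / n := by
  obtain rfl : t = 1 - s := by linarith
  have hd : 0 < p - q := sub_pos.mpr hqp
  have hv : (s * p) • a + ((1 - s) * q) • b - q • (s • a + (1 - s) • b) = (s * (p - q)) • a := by
    module
  have hd2 : s * p + (1 - s) * q - q = s * (p - q) := by ring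
  rw [Tp, hv, hd2, norm_smul, Real.norm_of_nonneg (mul_pos hs hd).le]
  have : s * (p - q) ≠ 0 := (mul_pos hs hd).ne'
  field_simp

lemma Tm_mixture (hqp : q < p) (ht : 0 < t) (hst : s + t = 1) (a b : En n) :
    Tm q p (s * p + t * q) (s • a + t • b) ((s * p) • a + (t * q) • b) = q * ‖b‖ ^ 2 / n := by
  obtain rfl : s = 1 - t := by linarith
  have hd : 0 < p - q := sub_pos.mpr hqp
  have hv : ((1 - t) * p) • a + (t * q) • b - p • ((1 - t) • a + t • b) = -(t * (p - q)) • b := by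
    module
  have hd2 : (1 - t) * p + t * q - p = -(t * (p - q)) := by ring
  rw [Tm, hv, hd2, norm_smul, norm_neg, Real.norm_of_nonneg (mul_pos ht hd).le]
  have : t * (p - q) ≠ 0 := (mul_pos ht hd).ne'
  field_simp

lemma Uset_subset_mixtureSet (hn : 0 < n) : Uset n q p e ⊆ mixtureSet n p q e := by
  rintro ⟨μ, w, m, σ, π⟩ ⟨⟨hqμ, hμp⟩, hTp, hTm, hQ⟩
  simp only [TpZ, TmZ, QZ] at hqμ hμp hTp hTm hQ
  have hqp : q < p := hqμ.trans hμp
  have hd : 0 < p - q := sub_pos.mpr hqp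
  have hq : 0 < μ - q := sub_pos.mpr hqμ
  have hp : 0 < p - μ := sub_pos.mpr hμp
  have hn' : (0 : ℝ) < n := Nat.cast_pos.mpr hn
  obtain ⟨s, hs⟩ : ∃ s, s = (μ - q) / (p - q) := ⟨_, rfl⟩
  obtain ⟨t, ht⟩ : ∃ t, t = (p - μ) / (p - q) := ⟨_, rfl⟩
  have hs0 : 0 < s := hs ▸ div_pos hq hd
  have ht0 : 0 < t := ht ▸ div_pos hp hd
  have hst : s + t = 1 := by rw [hs, ht]; field_simp; ring
  obtain ⟨a, ha⟩ : ∃ a, a = (μ - q)⁻¹ • (m - q • w) := ⟨_, rfl⟩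
  obtain ⟨b, hb⟩ : ∃ b, b = (p - μ)⁻¹ • (p • w - m) := ⟨_, rfl⟩
  have hsa : s • a = (p - q)⁻¹ • (m - q • w) := by
    rw [ha, smul_smul, hs]
    congr 1
    field_simp
  have htb : t • b = (p - q)⁻¹ • (p • w - m) := by
    rw [hb, smul_smul, ht]
    congr 1
    field_simp
  have hw : w = s • a + t • b := by
    rw [hsa, htb, ← smul_add, eq_inv_smul_iff₀ hd.ne']
    module
  have hm : m = (s * p) • a + (t * q) • b := by
    rw [mul_comm s, mul_comm t, mul_smul, mul_smul, hsa, htb, smul_comm p, smul_comm q,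
      ← smul_add, eq_inv_smul_iff₀ hd.ne']
    module
  have hμ : μ = s * p + t * q := by rw [hs, ht]; field_simp; ring
  clear hs ht ha hb hsa htb
  subst hμ hw hm
  rw [Tp_mixture hqp hs0 hst, div_lt_iff₀ hn'] at hTp
  rw [Tm_mixture hqp ht0 hst, div_lt_iff₀ hn'] at hTm
  rw [Mmat_mixture hqp hs0 ht0 hst] at hQ
  refine ⟨s, t, a, b, hs0.le, ht0.le, hst, rfl, rfl, rfl, by linarith, by linarith, fun ξ => ?_⟩
  have h := quadForm_le_lamMax ((s * p) • op a a + (t * q) • op b b - (σ : Matrix _ _ ℝ)) ξ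
  simp only [quadForm_sub, quadForm_add, quadForm_smul, quadForm_op] at h
  nlinarith [sq_nonneg ‖ξ‖]

lemma continuous_quadForm_stress (ξ : En n) :
    Continuous fun z : Zsp n => quadForm (z.2.2.2.1 : Matrix (Fin n) (Fin n) ℝ) ξ := by
  have h : Continuous fun z : Zsp n => (z.2.2.2.1 : Matrix (Fin n) (Fin n) ℝ) :=
    continuous_subtype_val.comp (by fun_prop)
  exact continuous_finsetSum _ fun i _ => continuous_finsetSum _ fun j _ =>
    (continuous_const.mul (h.matrix_elem i j)).mul continuous_const

lemma norm_le_sqrt_of_energy_le {c : ℝ} (hp : 0 < p) (h : p * ‖a‖ ^ 2 ≤ c) :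
    ‖a‖ ≤ √(c / p) :=
  Real.le_sqrt_of_sq_le (by rwa [le_div_iff₀ hp, mul_comm])

lemma isClosed_mixtureSet (hp : 0 < p) (hq : 0 < q) : IsClosed (mixtureSet n p q e) := by
  let T : Set (ℝ × ℝ × En n × En n) := Set.Icc 0 1 ×ˢ Set.Icc 0 1 ×ˢ
    Metric.closedBall 0 √(n * e / p) ×ˢ Metric.closedBall 0 √(n * e / q)
  have hT : IsCompact T := isCompact_Icc.prod (isCompact_Icc.prod
    ((isCompact_closedBall _ _).prod (isCompact_closedBall _ _)))
  have : CompactSpace T := isCompact_iff_compactSpace.mp hT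
  let S : Set (T × Zsp n) := {x | IsMixture p q e x.2 x.1.1.1 x.1.1.2.1 x.1.1.2.2.1 x.1.1.2.2.2}
  have hS : IsClosed S := by
    have : S = {x : T × Zsp n | 0 ≤ x.1.1.1 ∧ 0 ≤ x.1.1.2.1 ∧ x.1.1.1 + x.1.1.2.1 = 1 ∧
        x.2.1 = x.1.1.1 * p + x.1.1.2.1 * q ∧
        x.2.2.1 = x.1.1.1 • x.1.1.2.2.1 + x.1.1.2.1 • x.1.1.2.2.2 ∧
        x.2.2.2.1 = (x.1.1.1 * p) • x.1.1.2.2.1 + (x.1.1.2.1 * q) • x.1.1.2.2.2 ∧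
        p * ‖x.1.1.2.2.1‖ ^ 2 ≤ n * e ∧ q * ‖x.1.1.2.2.2‖ ^ 2 ≤ n * e ∧
        ∀ ξ : En n, x.1.1.1 * p * inner ℝ x.1.1.2.2.1 ξ ^ 2 +
          x.1.1.2.1 * q * inner ℝ x.1.1.2.2.2 ξ ^ 2 -
          quadForm (x.2.2.2.2.1 : Matrix (Fin n) (Fin n) ℝ) ξ ≤ e * ‖ξ‖ ^ 2} :=
      Set.ext fun x => ⟨fun ⟨h1, h2, h3, h4, h5, h6, h7, h8, h9⟩ =>
        ⟨h1, h2, h3, h4, h5, h6, h7, h8, h9⟩, fun ⟨h1, h2, h3, h4, h5, h6, h7, h8, h9⟩ =>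
        ⟨h1, h2, h3, h4, h5, h6, h7, h8, h9⟩⟩
    rw [this]
    simp only [Set.ofPred_and, Set.ofPred_forall]
    refine (isClosed_le (by fun_prop) (by fun_prop)).inter <|
      (isClosed_le (by fun_prop) (by fun_prop)).inter <|
      (isClosed_eq (by fun_prop) (by fun_prop)).inter <|
      (isClosed_eq (by fun_prop) (by fun_prop)).inter <|
      (isClosed_eq (by fun_prop) (by fun_prop)).inter <|
      (isClosed_eq (by fun_prop) (by fun_prop)).inter <|
      (isClosed_le (by fun_prop) (by fun_prop)).inter <|
      (isClosed_le (by fun_prop) (by fun_prop)).inter ?_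
    refine isClosed_iInter fun ξ => isClosed_le (.sub (by fun_prop) ?_) (by fun_prop)
    exact (continuous_quadForm_stress ξ).comp continuous_snd
  convert isClosedMap_snd_of_compactSpace S hS
  ext z
  constructor
  · rintro ⟨s, t, a, b, h⟩
    have := h.add_eq_one
    have h1 := h.nonneg_left
    have h2 := h.nonneg_right
    refine ⟨(⟨(s, t, a, b), ⟨h1, by linarith⟩, ⟨h2, by linarith⟩, ?_, ?_⟩, z), h, rfl⟩
    · simpa using norm_le_sqrt_of_energy_le hp h.energy_left
    · simpa using norm_le_sqrt_of_energy_le hq h.energy_right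
  · rintro ⟨x, hx, rfl⟩
    exact ⟨_, _, _, _, hx⟩

/-- Mixtures with both phases present are limits of `Uset`, by shrinking velocities. -/
lemma IsMixture.mem_closure_Uset_of_pos (hn : 0 < n) (hqp : q < p) (he : 0 < e)
    (h : IsMixture p q e z s t a b) (hs : 0 < s) (ht : 0 < t) : z ∈ closure (Uset n q p e) := by
  have hn' : (0 : ℝ) < n := Nat.cast_pos.mpr hn
  have hst := h.add_eq_one
  let f (r : ℝ) : Zsp n := (z.1, r • z.2.1, r • z.2.2.1, r ^ 2 • z.2.2.2.1, z.2.2.2.2)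
  have hf : Filter.Tendsto f (nhdsWithin 1 (Set.Iio 1)) (nhds z) := by
    have hc : Continuous f := by fun_prop
    have := hc.tendsto 1
    simp only [f, one_smul, one_pow] at this
    exact this.mono_left nhdsWithin_le_nhds
  refine mem_closure_of_tendsto hf ?_
  filter_upwards [Ioo_mem_nhdsLT (zero_lt_one' ℝ)] with r hr
  have hr2 : r ^ 2 < 1 := by nlinarith [hr.1, hr.2]
  have hw : r • z.2.1 = s • (r • a) + t • (r • b) := by
    rw [h.velocity]
    module
  have hm : r • z.2.2.1 = (s * p) • (r • a) + (t * q) • (r • b) := by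
    rw [h.momentum]
    module
  have hE {x : ℝ} (hx : x ≤ n * e) : r ^ 2 * x < e * n := by
    nlinarith [mul_pos hn' he, sq_nonneg r]
  refine ⟨?_, ?_, ?_, ?_⟩
  · simp only [f, h.density, Set.mem_Ioo]
    constructor <;> nlinarith [mul_pos hs (sub_pos.mpr hqp), mul_pos ht (sub_pos.mpr hqp),
      congrArg (· * p) hst, congrArg (· * q) hst]
  · simp only [f, TpZ, hw, hm, h.density]
    rw [Tp_mixture hqp hs hst, div_lt_iff₀ hn', norm_smul, mul_pow, Real.norm_eq_abs, sq_abs,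
      mul_left_comm]
    exact hE h.energy_left
  · simp only [f, TmZ, hw, hm, h.density]
    rw [Tm_mixture hqp ht hst, div_lt_iff₀ hn', norm_smul, mul_pow, Real.norm_eq_abs, sq_abs,
      mul_left_comm]
    exact hE h.energy_right
  · simp only [f, QZ, hw, hm, h.density]
    rw [Mmat_mixture hqp hs ht hst]
    refine (lamMax_le hn (c := r ^ 2 * e) fun ξ hξ => ?_).trans_lt (by nlinarith)
    have := h.stress ξ
    simp only [quadForm_sub, quadForm_add, quadForm_smul, quadForm_op, Submodule.coe_smul,
      real_inner_smul_left]
    rw [hξ] at this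
    linear_combination r ^ 2 * this

/-- A pure phase is a limit of mixtures containing a small amount of the other phase at rest. -/
lemma IsMixture.tendsto_of_pure_left (he : 0 < e) (hp : 0 < p) (h : IsMixture p q e z 1 0 a b) :
    ∃ f : ℝ → Zsp n, Filter.Tendsto f (nhdsWithin 0 (Set.Ioi 0)) (nhds z) ∧
      ∀ r ∈ Set.Ioo (0 : ℝ) 1, IsMixture p q e (f r) (1 - r) r a 0 := by
  refine ⟨fun r => ((1 - r) * p + r * q, (1 - r) • a, ((1 - r) * p) • a, z.2.2.2), ?_,
    fun r hr => ⟨by linarith [hr.2], hr.1.le, by ring, rfl, by simp, by simp, h.energy_left,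
      by simp; positivity, fun ξ => ?_⟩⟩
  · have hc : Continuous fun r : ℝ =>
        (((1 - r) * p + r * q, (1 - r) • a, ((1 - r) * p) • a, z.2.2.2) : Zsp n) := by
      fun_prop
    have h0 : z = ((1 - 0) * p + 0 * q, (1 - 0 : ℝ) • a, ((1 - 0) * p) • a, z.2.2.2) :=
      Prod.ext (by simpa using h.density) (Prod.ext (by simpa using h.velocity)
        (Prod.ext (by simpa using h.momentum) rfl))
    have hlim := (hc.tendsto 0).mono_left (nhdsWithin_le_nhds (s := Set.Ioi 0))
    rwa [← h0] at hlim
  · have h1 := h.stress ξ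
    simp only [one_mul, zero_mul, add_zero] at h1
    simp only [inner_zero_left]
    nlinarith [mul_nonneg hr.1.le (mul_nonneg hp.le (sq_nonneg (inner ℝ a ξ)))]

lemma mixtureSet_subset_closure_Uset (hn : 0 < n) (hq : 0 < q) (hqp : q < p) (he : 0 < e) :
    mixtureSet n p q e ⊆ closure (Uset n q p e) := by
  rintro z ⟨s, t, a, b, h⟩
  have hst := h.add_eq_one
  have hI : Set.Ioo (0 : ℝ) 1 ∈ nhdsWithin 0 (Set.Ioi 0) := Ioo_mem_nhdsGT zero_lt_one
  rcases h.nonneg_left.eq_or_lt' with rfl | hs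
  · obtain rfl : t = 1 := by linarith
    obtain ⟨f, hf, hmix⟩ := h.symm.tendsto_of_pure_left he hq
    refine closure_closure.subset (mem_closure_of_tendsto hf ?_)
    filter_upwards [hI] with r hr
    exact (hmix r hr).symm.mem_closure_Uset_of_pos hn hqp he hr.1 (sub_pos.mpr hr.2)
  rcases h.nonneg_right.eq_or_lt' with rfl | ht
  · obtain rfl : s = 1 := by linarith
    obtain ⟨f, hf, hmix⟩ := h.tendsto_of_pure_left he (hq.trans hqp)
    refine closure_closure.subset (mem_closure_of_tendsto hf ?_)
    filter_upwards [hI] with r hr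
    exact (hmix r hr).mem_closure_Uset_of_pos hn hqp he (sub_pos.mpr hr.2) hr.1
  · exact h.mem_closure_Uset_of_pos hn hqp he hs ht

lemma closure_Uset (hn : 0 < n) (hq : 0 < q) (hqp : q < p) (he : 0 < e) :
    closure (Uset n q p e) = mixtureSet n p q e :=
  (closure_minimal (Uset_subset_mixtureSet hn) (isClosed_mixtureSet (hq.trans hqp) hq)).antisymm
    (mixtureSet_subset_closure_Uset hn hq hqp he)

end Closure

/-- Every `z ∈ closure(U) \ K` admits a nonzero wave-cone direction `z̄`
with `z ± z̄ ∈ closure(U)`. -/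
theorem perturbation_in_closure_U (n : ℕ) (hn : 2 ≤ n) (μm μp : ℝ) (hμm : 0 < μm)
    (hμ : μm < μp) (e : ℝ) (he : 0 < e) (z : Zsp n)
    (hz : z ∈ closure (Uset n μm μp e) \ Kset n μm μp e) :
    ∃ zb ∈ Lambda n, zb ≠ 0 ∧
      z + zb ∈ closure (Uset n μm μp e) ∧ z - zb ∈ closure (Uset n μm μp e) := by
  rw [closure_Uset (by omega) hμm hμ he] at hz ⊢
  obtain ⟨zb, hzb, hadd, hsub⟩ :=
    exists_perturbation_mixtureSet hn (hμm.trans hμ) hμm hμ.ne' hz.1 hz.2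
  exact ⟨zb, hzb, ne_zero_of_mem_Lambda hzb, hadd, hsub⟩
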